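/- arXiv:1612.08981 — 2 statements merged into one kernel-verified Lean document; each statement's English description precedes it below -/
import Mathlib

section
/- Let n ≥ 1 and let S be a nonempty subset of ℤ_{≥1} × ℤⁿ that is closed under addition. Regard S as a subset of ℝ × ℝⁿ and let C ⊆ ℝ × ℝⁿ be the smallest closed convex cone containing S, i.e. the topological closure of the set of all finite nonnegative real linear combinations of elements of S. Then {x ∈ ℝⁿ : (1, x) ∈ C} equals the topological closure of the convex hull of the set { x/k : (k, x) ∈ S } ⊆ ℝⁿ. -/
open Filter Topology in
/-- The level-one slice of the closed convex cone generated by points of positive height is the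
closed convex hull of the points rescaled to height one. -/
theorem slice_closure_cone_eq_closure_convexHull {α E : Type*} [AddCommGroup E] [Module ℝ E]
    [TopologicalSpace E] [ContinuousSMul ℝ E] (S : Set α) (h : α → ℝ) (u : α → E)
    (hpos : ∀ p ∈ S, 0 < h p) :
    {x : E | ((1 : ℝ), x) ∈ closure {y : ℝ × E |
        ∃ (k : ℕ) (c : Fin k → ℝ) (v : Fin k → α),
          (∀ i, 0 ≤ c i) ∧ (∀ i, v i ∈ S) ∧ y = ∑ i, c i • (h (v i), u (v i))}} =
      closure (convexHull ℝ {x : E | ∃ p ∈ S, x = (h p)⁻¹ • u p}) := by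
  apply Set.Subset.antisymm
  · intro x hx
    have hcont : Tendsto (fun y : ℝ × E => y.1⁻¹ • y.2) (𝓝 (1, x)) (𝓝 x) := by
      have h_at : ContinuousAt (fun y : ℝ × E => y.1⁻¹ • y.2) (1, x) :=
        (continuousAt_fst.inv₀ one_ne_zero).smul continuousAt_snd
      simpa [ContinuousAt] using h_at
    have hev : ∀ᶠ y : ℝ × E in 𝓝 (1, x), 0 < y.1 :=
      continuousAt_fst.eventually (lt_mem_nhds one_pos)
    refine mem_closure_of_frequently_of_tendsto
      (((mem_closure_iff_frequently.1 hx).and_eventually hev).mono ?_) hcont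
    rintro _ ⟨⟨k, c, v, hc, hv, rfl⟩, ht⟩
    simp only [Prod.fst_sum, Prod.snd_sum, Prod.smul_mk, smul_eq_mul] at ht ⊢
    have hmem := (convex_convexHull ℝ {x : E | ∃ p ∈ S, x = (h p)⁻¹ • u p}).centerMass_mem
      (t := Finset.univ) (w := fun i => c i * h (v i)) (z := fun i => (h (v i))⁻¹ • u (v i))
      (fun i _ => mul_nonneg (hc i) (hpos _ (hv i)).le) ht
      (fun i _ => subset_convexHull ℝ _ ⟨v i, hv i, rfl⟩)
    convert hmem using 1
    rw [Finset.centerMass]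
    congr 1
    refine Finset.sum_congr rfl fun i _ => ?_
    rw [smul_smul, mul_inv_cancel_right₀ (hpos _ (hv i)).ne']
  · refine closure_minimal (fun x hx => subset_closure ?_)
      (isClosed_closure.preimage (Continuous.prodMk_right (1 : ℝ)))
    obtain ⟨ι, _, w, z, hw, hw1, hz, rfl⟩ := mem_convexHull_iff_exists_fintype.1 hx
    choose p hp hzp using hz
    let e := (Fintype.equivFin ι).symm
    refine ⟨Fintype.card ι, fun i => w (e i) * (h (p (e i)))⁻¹, fun i => p (e i),
      fun i => mul_nonneg (hw _) (inv_nonneg.2 (hpos _ (hp _)).le), fun i => hp _, ?_⟩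
    rw [e.sum_comp fun i => (w i * (h (p i))⁻¹) • (h (p i), u (p i))]
    ext1
    · simp only [Prod.fst_sum, Prod.smul_mk, smul_eq_mul]
      rw [← hw1]
      refine Finset.sum_congr rfl fun i _ => ?_
      rw [inv_mul_cancel_right₀ (hpos _ (hp i)).ne']
    · simp only [Prod.snd_sum, Prod.smul_mk]
      refine Finset.sum_congr rfl fun i _ => ?_
      rw [hzp, smul_smul]

/-- Let `S` be a nonempty subset of `ℤ_{≥1} × ℤⁿ` closed under
addition. Regard `S` inside `ℝ × ℝⁿ` and let `C` be the smallest closed convex cone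
containing `S`, i.e. the topological closure of the set of all finite nonnegative real
linear combinations of elements of `S`. Then the level-1 slice `{x : (1, x) ∈ C}`
equals the topological closure of the convex hull of `{ x/k : (k, x) ∈ S }`. -/
theorem newton_okounkov_body_eq_closure_convexHull
    {n : ℕ} (hn : 1 ≤ n)
    (S : Set (ℤ × (Fin n → ℤ)))
    (hne : S.Nonempty)
    (hpos : ∀ p ∈ S, 1 ≤ p.1)
    (hadd : ∀ p ∈ S, ∀ q ∈ S, p + q ∈ S) :
    {x : Fin n → ℝ |
        ((1 : ℝ), x) ∈
          closure {y : ℝ × (Fin n → ℝ) |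
            ∃ (k : ℕ) (c : Fin k → ℝ) (v : Fin k → ℤ × (Fin n → ℤ)),
              (∀ i, 0 ≤ c i) ∧ (∀ i, v i ∈ S) ∧
                y = ∑ i, c i • (((v i).1 : ℝ), fun j => ((v i).2 j : ℝ))}} =
      closure (convexHull ℝ
        {x : Fin n → ℝ | ∃ p ∈ S, x = fun j => (p.2 j : ℝ) / (p.1 : ℝ)}) := by
  have key := slice_closure_cone_eq_closure_convexHull S (fun p => (p.1 : ℝ))
    (fun p j => (p.2 j : ℝ)) fun p hp => Int.cast_pos.2 (hpos p hp)
  simpa only [Pi.smul_def, smul_eq_mul, ← div_eq_inv_mul] using key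
end

section
/- Let n ≥ 1, let S be an additive submonoid of ℕ × ℤⁿ, and let M be an additive subgroup of ℤⁿ. Suppose the subgroup of ℤ × ℤⁿ generated by S equals {(k, v) : k ∈ ℤ, v ∈ M}. Then there exists an integer d ≥ 1 such that the subgroup of ℤⁿ generated by the level set S_d := {v ∈ ℤⁿ : (d, v) ∈ S} equals M. -/
open Filter

section

variable {G : Type*} [AddCommGroup G]

theorem AddSubmonoid.exists_sub_of_mem_closure (S : AddSubmonoid (ℕ × G)) {x : ℤ × G}
    (hx : x ∈ AddSubgroup.closure
      ((fun p : ℕ × G => ((p.1 : ℤ), p.2)) '' (S : Set (ℕ × G)))) :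
    ∃ s ∈ S, ∃ t ∈ S, x = ((s.1 : ℤ) - t.1, s.2 - t.2) := by
  induction hx using AddSubgroup.closure_induction with
  | mem x hx =>
    obtain ⟨s, hs, rfl⟩ := hx
    exact ⟨s, hs, 0, S.zero_mem, by simp⟩
  | zero => exact ⟨0, S.zero_mem, 0, S.zero_mem, by simp; rfl⟩
  | add x y _ _ hx hy =>
    obtain ⟨s, hs, t, ht, rfl⟩ := hx
    obtain ⟨s', hs', t', ht', rfl⟩ := hy
    refine ⟨s + s', S.add_mem hs hs', t + t', S.add_mem ht ht', Prod.ext ?_ ?_⟩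
    · simp; ring
    · simp; abel
  | neg x _ hx =>
    obtain ⟨s, hs, t, ht, rfl⟩ := hx
    exact ⟨t, ht, s, hs, by simp⟩

theorem AddSubmonoid.eventually_level_nonempty (S : AddSubmonoid (ℕ × G)) {c : ℕ} {v : G}
    (hc : (c, v) ∈ S) (hc' : (c + 1, v) ∈ S) :
    ∀ᶠ d : ℕ in atTop, ∃ x, (d, x) ∈ S := by
  rcases Nat.eq_zero_or_pos c with rfl | hpos
  · exact Eventually.of_forall fun d => ⟨d • v, by simpa using S.nsmul_mem hc' d⟩
  filter_upwards [eventually_ge_atTop (c * c)] with d hd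
  have hq : c ≤ d / c := (Nat.le_div_iff_mul_le hpos).2 hd
  have hr : d % c < c := Nat.mod_lt d hpos
  obtain ⟨k, hk⟩ := Nat.exists_eq_add_of_le (hr.le.trans hq)
  have hdeg : k * c + d % c * (c + 1) = d := by
    have := Nat.div_add_mod d c
    rw [hk] at this
    linarith
  refine ⟨k • v + (d % c) • v, ?_⟩
  have hmem := S.add_mem (S.nsmul_mem hc k) (S.nsmul_mem hc' (d % c))
  simpa only [Prod.smul_mk, Prod.mk_add_mk, smul_eq_mul, hdeg] using hmem

theorem AddSubmonoid.eventually_sub_mem_closure_level (S : AddSubmonoid (ℕ × G))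
    (hS : ∀ᶠ d : ℕ in atTop, ∃ x, (d, x) ∈ S) {a : ℕ} {v w : G}
    (hv : (a, v) ∈ S) (hw : (a, w) ∈ S) :
    ∀ᶠ d : ℕ in atTop, v - w ∈ AddSubgroup.closure {x : G | (d, x) ∈ S} := by
  filter_upwards [(tendsto_sub_atTop_nat a).eventually hS, eventually_ge_atTop a]
    with d ⟨x, hx⟩ had
  have key : ∀ u, (a, u) ∈ S → (d, u + x) ∈ S := fun u hu => by
    simpa [Nat.add_sub_cancel' had] using S.add_mem hu hx
  rw [← add_sub_add_right_eq_sub v w x]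
  exact sub_mem (AddSubgroup.subset_closure (key v hv)) (AddSubgroup.subset_closure (key w hw))

end


/-- Let `S` be an additive submonoid of `ℕ × ℤⁿ` and `M` an additive
subgroup of `ℤⁿ`. If the subgroup of `ℤ × ℤⁿ` generated by (the image of) `S` equals
`{(k, v) : k ∈ ℤ, v ∈ M} = ℤ × M`, then there is an integer `d ≥ 1` such that the
subgroup of `ℤⁿ` generated by the level set `S_d = {v : (d, v) ∈ S}` equals `M`. -/
theorem exists_level_generating_lattice
    {n : ℕ} (hn : 1 ≤ n)
    (S : AddSubmonoid (ℕ × (Fin n → ℤ)))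
    (M : AddSubgroup (Fin n → ℤ))
    (h : AddSubgroup.closure
        ((fun p : ℕ × (Fin n → ℤ) => ((p.1 : ℤ), p.2)) '' (S : Set (ℕ × (Fin n → ℤ)))) =
      AddSubgroup.prod (⊤ : AddSubgroup ℤ) M) :
    ∃ d : ℕ, 1 ≤ d ∧
      AddSubgroup.closure {v : Fin n → ℤ | (d, v) ∈ S} = M := by
  have hdiff : ∀ k : ℤ, ∀ u ∈ M, ∃ s ∈ S, ∃ t ∈ S, (k, u) = ((s.1 : ℤ) - t.1, s.2 - t.2) :=
    fun k u hu => S.exists_sub_of_mem_closure (h ▸ ⟨AddSubgroup.mem_top k, hu⟩)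
  have hlevel : ∀ᶠ d : ℕ in atTop, ∃ x, (d, x) ∈ S := by
    obtain ⟨⟨a, v⟩, hs, ⟨c, w⟩, ht, hst⟩ := hdiff 1 0 M.zero_mem
    obtain ⟨h1, h2⟩ := Prod.mk.inj hst
    obtain rfl : v = w := sub_eq_zero.1 h2.symm
    obtain rfl : a = c + 1 := by dsimp only at h1; omega
    exact S.eventually_level_nonempty ht hs
  have hmem : ∀ u ∈ M, ∀ᶠ d : ℕ in atTop, u ∈ AddSubgroup.closure {v | (d, v) ∈ S} := by
    intro u hu
    obtain ⟨⟨a, v⟩, hs, ⟨c, w⟩, ht, hst⟩ := hdiff 0 u hu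
    obtain ⟨h1, rfl⟩ := Prod.mk.inj hst
    obtain rfl : a = c := by dsimp only at h1; omega
    exact S.eventually_sub_mem_closure_level hlevel hs ht
  obtain ⟨F, hF⟩ : M.FG := by
    have := IsNoetherian.noetherian (AddSubgroup.toIntSubmodule M)
    rwa [Submodule.fg_iff_addSubgroup_fg] at this
  have hall : ∀ᶠ d : ℕ in atTop, ∀ u ∈ F, u ∈ AddSubgroup.closure {v | (d, v) ∈ S} :=
    (eventually_all_finset F).2 fun u hu => hmem u (hF ▸ AddSubgroup.subset_closure hu)
  obtain ⟨d, hd, hd1⟩ := (hall.and (eventually_ge_atTop 1)).exists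
  refine ⟨d, hd1, le_antisymm ((AddSubgroup.closure_le M).2 fun v hv => ?_) ?_⟩
  · have hv' : ((d : ℤ), v) ∈ AddSubgroup.prod (⊤ : AddSubgroup ℤ) M :=
      h ▸ AddSubgroup.subset_closure ⟨(d, v), hv, rfl⟩
    exact hv'.2
  · rw [← hF, AddSubgroup.closure_le]
    exact hd
end
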